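/- arXiv:1001.2715 — 5 statements merged into one kernel-verified Lean document; each statement's English description precedes it below -/
import Mathlib

section
/- Let T > 0, let c : ℝ → ℝ be globally Lipschitz with constant L, and let κ : ℝ → ℝ be bounded and globally Lipschitz. Then for every continuous function w : [0,T] → ℝ there exists a unique continuous function x : [0,T] → ℝ satisfying the Volterra-type integral equation x(t) = c( w(t) − ∫₀ᵗ κ(x(s)) ds ) for all t ∈ [0,T]. -/
open Set MeasureTheory

/-- Primitives of a continuous function on `[0,T]` are differentiable, one-sidedly at the ends. -/
lemma hasDerivWithinAt_integral_Icc {T : ℝ} {g : ℝ → ℝ} (hg : ContinuousOn g (Icc 0 T))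
    {t : ℝ} (ht : t ∈ Icc (0 : ℝ) T) :
    HasDerivWithinAt (fun t => ∫ s in (0 : ℝ)..t, g s) (g t) (Icc 0 T) t := by
  have : Fact (t ∈ Icc (0 : ℝ) T) := ⟨ht⟩
  exact intervalIntegral.integral_hasDerivWithinAt_right
    (hg.mono (uIcc_subset_Icc ⟨le_rfl, ht.1.trans ht.2⟩ ht)).intervalIntegrable
    (hg.stronglyMeasurableAtFilter_nhdsWithin measurableSet_Icc t) (hg t ht)

/-- Newton-Leibniz on `[0,t] ⊆ [0,T]` for a function vanishing at `0`. -/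
lemma integral_eq_of_hasDerivWithinAt_Icc {T : ℝ} {z g : ℝ → ℝ} (hz0 : z 0 = 0)
    (hz : ∀ t ∈ Icc 0 T, HasDerivWithinAt z (g t) (Icc 0 T) t)
    (hg : ContinuousOn g (Icc 0 T)) {t : ℝ} (ht : t ∈ Icc (0 : ℝ) T) :
    ∫ s in (0 : ℝ)..t, g s = z t := by
  have hsub : Icc 0 t ⊆ Icc 0 T := Icc_subset_Icc_right ht.2
  rw [intervalIntegral.integral_eq_sub_of_hasDerivAt_of_le ht.1
    ((HasDerivWithinAt.continuousOn hz).mono hsub) (fun s hs => ?_)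
    ((hg.mono (by rwa [uIcc_of_le ht.1])).intervalIntegrable), hz0, sub_zero]
  exact (hz s (hsub (Ioo_subset_Icc_self hs))).hasDerivAt
    (Icc_mem_nhds hs.1 (hs.2.trans_le ht.2))

/-- Let `T > 0`, let `c : ℝ → ℝ` be globally Lipschitz with constant `L`,
and let `κ : ℝ → ℝ` be bounded and globally Lipschitz. Then for every continuous
`w : [0,T] → ℝ` there is a unique continuous `x : [0,T] → ℝ` with
`x t = c (w t - ∫₀ᵗ κ (x s) ds)` for all `t ∈ [0,T]`. -/
theorem volterra_exists_unique
    (T : ℝ) (hT : 0 < T) (c κ : ℝ → ℝ)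
    (L : NNReal) (hc : LipschitzWith L c)
    (M : ℝ) (hκb : ∀ u : ℝ, |κ u| ≤ M)
    (Lκ : NNReal) (hκ : LipschitzWith Lκ κ)
    (w : ℝ → ℝ) (hw : ContinuousOn w (Icc 0 T)) :
    ∃ x : ℝ → ℝ,
      (ContinuousOn x (Icc 0 T) ∧
        ∀ t ∈ Icc (0:ℝ) T, x t = c (w t - ∫ s in (0:ℝ)..t, κ (x s))) ∧
      ∀ y : ℝ → ℝ, ContinuousOn y (Icc 0 T) →
        (∀ t ∈ Icc (0:ℝ) T, y t = c (w t - ∫ s in (0:ℝ)..t, κ (y s))) →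
        ∀ t ∈ Icc (0:ℝ) T, y t = x t := by
  have hM : 0 ≤ M := (abs_nonneg _).trans (hκb 0)
  have hlip : ∀ t, LipschitzWith (Lκ * L) (fun z => κ (c (w t - z))) := fun t =>
    hκ.comp (LipschitzWith.of_dist_le_mul fun a b => by
      simpa only [dist_sub_left] using hc.dist_le_mul (w t - a) (w t - b))
  have hPL : IsPicardLindelof (fun t z => κ (c (w t - z))) (tmin := 0) (tmax := T)
      ⟨0, le_rfl, hT.le⟩ 0 ⟨M * T, by positivity⟩ 0 ⟨M, hM⟩ (Lκ * L) :=
    { lipschitzOnWith := fun t _ => (hlip t).lipschitzOnWith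
      continuousOn := fun z _ => hκ.continuous.comp_continuousOn
        (hc.continuous.comp_continuousOn (hw.sub continuousOn_const))
      norm_le := fun t _ z _ => hκb _
      mul_max_le := by simp [hT.le]; rfl }
  obtain ⟨z, hz0, hz⟩ := hPL.exists_eq_forall_mem_Icc_hasDerivWithinAt₀
  have hzc : ContinuousOn z (Icc 0 T) := HasDerivWithinAt.continuousOn hz
  have hx : ContinuousOn (fun t => c (w t - z t)) (Icc 0 T) :=
    hc.continuous.comp_continuousOn (hw.sub hzc)
  refine ⟨fun t => c (w t - z t), ⟨hx, fun t ht => ?_⟩, fun y hy hyeq t ht => ?_⟩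
  · rw [integral_eq_of_hasDerivWithinAt_Icc hz0 hz (hκ.continuous.comp_continuousOn hx) ht]
  · have hv : ∀ t ∈ Icc (0 : ℝ) T, HasDerivWithinAt (fun t => ∫ s in (0 : ℝ)..t, κ (y s))
        (κ (c (w t - ∫ s in (0 : ℝ)..t, κ (y s)))) (Icc 0 T) t := fun t ht => by
      rw [← hyeq t ht]
      exact hasDerivWithinAt_integral_Icc (hκ.continuous.comp_continuousOn hy) ht
    have hright : ∀ t ∈ Ico (0 : ℝ) T, Icc 0 T ∈ nhdsWithin t (Ici t) := fun t ht =>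
      Filter.mem_of_superset (Icc_mem_nhdsGE ht.2) (Icc_subset_Icc_left ht.1)
    have huniq := ODE_solution_unique hlip (HasDerivWithinAt.continuousOn hv)
      (fun t ht => (hv t (Ico_subset_Icc_self ht)).mono_of_mem_nhdsWithin (hright t ht))
      hzc (fun t ht => (hz t (Ico_subset_Icc_self ht)).mono_of_mem_nhdsWithin (hright t ht))
      (by simpa using hz0.symm)
    rw [hyeq t ht]
    exact congrArg (fun r => c (w t - r)) (huniq ht)
end

section
/- Let T > 0, let c : ℝ → ℝ be globally Lipschitz with constant L_c, and let κ : ℝ → ℝ be bounded and globally Lipschitz with constant L_κ. For w ∈ C_T let x_w ∈ C_T denote the unique solution of x(t) = c( w(t) − ∫₀ᵗ κ(x(s)) ds ). Then the solution map w ↦ x_w is Lipschitz from (C_T, sup norm) to itself: for all w, v ∈ C_T and all t ∈ [0,T], |x_w(t) − x_v(t)| ≤ L_c · e^{L_c L_κ t} · sup_{0 ≤ s ≤ t} |w(s) − v(s)|. -/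
open Set MeasureTheory

/-- **Grönwall's inequality**, integral form with a constant coefficient. -/
theorem le_mul_exp_of_le_add_mul_integral {u : ℝ → ℝ} {a K b : ℝ} (hK : 0 ≤ K)
    (hu : ContinuousOn u (Icc 0 b))
    (h : ∀ t ∈ Icc 0 b, u t ≤ a + K * ∫ s in (0:ℝ)..t, u s) :
    ∀ t ∈ Icc 0 b, u t ≤ a * Real.exp (K * t) := by
  intro t ht
  have hb : (0:ℝ) ≤ b := ht.1.trans ht.2
  have hint : IntervalIntegrable u volume 0 b := hu.intervalIntegrable_of_Icc hb
  have hcont : ContinuousOn (fun t => a + K * ∫ s in (0:ℝ)..t, u s) (Icc 0 b) := by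
    refine continuousOn_const.add (continuousOn_const.mul ?_)
    rw [← uIcc_of_le hb]
    exact intervalIntegral.continuousOn_primitive_interval' hint left_mem_uIcc
  have hderiv : ∀ x ∈ Ico 0 b,
      HasDerivWithinAt (fun t => a + K * ∫ s in (0:ℝ)..t, u s) (K * u x) (Ici x) x := by
    intro x hx
    have hnhds : Icc 0 b ∈ nhdsWithin x (Ioi x) :=
      Filter.mem_of_superset (Ioo_mem_nhdsGT hx.2)
        fun y hy => ⟨hx.1.trans hy.1.le, hy.2.le⟩
    refine ((intervalIntegral.integral_hasDerivWithinAt_right (s := Ici x) (t := Ioi x)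
      ?_ ?_ ?_).const_mul K).const_add a
    · exact (hu.mono (Icc_subset_Icc_right hx.2.le)).intervalIntegrable_of_Icc hx.1
    · exact ⟨Icc 0 b, hnhds, hu.aestronglyMeasurable measurableSet_Icc⟩
    · exact (hu x ⟨hx.1, hx.2.le⟩).mono_of_mem_nhdsWithin hnhds
  have hG := le_gronwallBound_of_liminf_deriv_right_le (δ := a) (K := K) (ε := 0) hcont
    (fun x hx r hr => (hderiv x hx).liminf_right_slope_le hr) (by simp)
    (fun x hx => by
      simpa using mul_le_mul_of_nonneg_left (h x ⟨hx.1, hx.2.le⟩) hK) t ht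
  rw [gronwallBound_ε0, sub_zero] at hG
  exact (h t ht).trans hG

/-- With `c` globally Lipschitz (constant `Lc`) and `κ` bounded and
globally Lipschitz (constant `Lκ`), the solution map `w ↦ x_w` of the Volterra-type
equation `x t = c (w t - ∫₀ᵗ κ (x s) ds)` is Lipschitz: for all `w, v ∈ C_T` and all
`t ∈ [0,T]`,
`|x_w t - x_v t| ≤ Lc · exp (Lc·Lκ·t) · sup_{0 ≤ s ≤ t} |w s - v s|`. -/
theorem solution_map_lipschitz
    (T : ℝ) (hT : 0 < T) (c κ : ℝ → ℝ)
    (Lc : NNReal) (hc : LipschitzWith Lc c)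
    (M : ℝ) (hκb : ∀ u : ℝ, |κ u| ≤ M)
    (Lκ : NNReal) (hκ : LipschitzWith Lκ κ)
    (w v : ℝ → ℝ) (hw : ContinuousOn w (Icc 0 T)) (hv : ContinuousOn v (Icc 0 T))
    (xw xv : ℝ → ℝ)
    (hxwc : ContinuousOn xw (Icc 0 T)) (hxvc : ContinuousOn xv (Icc 0 T))
    (hxw : ∀ t ∈ Icc (0:ℝ) T, xw t = c (w t - ∫ s in (0:ℝ)..t, κ (xw s)))
    (hxv : ∀ t ∈ Icc (0:ℝ) T, xv t = c (v t - ∫ s in (0:ℝ)..t, κ (xv s))) :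
    ∀ t ∈ Icc (0:ℝ) T,
      |xw t - xv t| ≤
        (Lc : ℝ) * Real.exp ((Lc : ℝ) * (Lκ : ℝ) * t) *
          ⨆ s : Icc (0:ℝ) t, |w s.1 - v s.1| := by
  intro t ht
  have hsub : Icc 0 t ⊆ Icc 0 T := Icc_subset_Icc_right ht.2
  have hbdd : BddAbove (range fun s : Icc (0:ℝ) t => |w s.1 - v s.1|) := by
    have := (isCompact_Icc.image_of_continuousOn ((hw.sub hv).abs.mono hsub)).bddAbove
    rwa [image_eq_range] at this
  set S := ⨆ s : Icc (0:ℝ) t, |w s.1 - v s.1|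
  have hle : ∀ r ∈ Icc 0 t,
      |xw r - xv r| ≤ Lc * S + (Lc * Lκ : ℝ) * ∫ s in (0:ℝ)..r, |xw s - xv s| := by
    intro r hr
    have hrT : Icc 0 r ⊆ Icc 0 T := Icc_subset_Icc_right (hr.2.trans ht.2)
    have hiw : IntervalIntegrable (fun s => κ (xw s)) volume 0 r :=
      (hκ.continuous.comp_continuousOn (hxwc.mono hrT)).intervalIntegrable_of_Icc hr.1
    have hiv : IntervalIntegrable (fun s => κ (xv s)) volume 0 r :=
      (hκ.continuous.comp_continuousOn (hxvc.mono hrT)).intervalIntegrable_of_Icc hr.1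
    have hix : IntervalIntegrable (fun s => |xw s - xv s|) volume 0 r :=
      ((hxwc.sub hxvc).abs.mono hrT).intervalIntegrable_of_Icc hr.1
    have hκint : |(∫ s in (0:ℝ)..r, κ (xw s)) - ∫ s in (0:ℝ)..r, κ (xv s)| ≤
        Lκ * ∫ s in (0:ℝ)..r, |xw s - xv s| := by
      rw [← intervalIntegral.integral_sub hiw hiv, ← intervalIntegral.integral_const_mul,
        ← Real.norm_eq_abs]
      exact intervalIntegral.norm_integral_le_of_norm_le hr.1
        (.of_forall fun s _ => hκ.dist_le_mul (xw s) (xv s))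
        (hix.const_mul _)
    have hS : |w r - v r| ≤ S := le_ciSup hbdd ⟨r, hr⟩
    rw [hxw r (hsub hr), hxv r (hsub hr)]
    calc _ ≤ (Lc : ℝ) * |(w r - ∫ s in (0:ℝ)..r, κ (xw s)) -
            (v r - ∫ s in (0:ℝ)..r, κ (xv s))| := hc.dist_le_mul _ _
      _ ≤ Lc * (S + Lκ * ∫ s in (0:ℝ)..r, |xw s - xv s|) := by
        gcongr
        rw [sub_sub_sub_comm]
        exact (abs_sub _ _).trans (add_le_add hS hκint)
      _ = _ := by ring
  have := le_mul_exp_of_le_add_mul_integral (by positivity)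
    ((hxwc.sub hxvc).abs.mono hsub) hle t ⟨ht.1, le_rfl⟩
  rwa [mul_right_comm] at this
end

section
/- Let T > 0, let c : ℝ → ℝ be globally Lipschitz, and let κ : ℝ → ℝ be bounded and globally Lipschitz. For w ∈ C_T let x_w ∈ C_T denote the unique solution of x(t) = c( w(t) − ∫₀ᵗ κ(x(s)) ds ). Then the solution map w ↦ x_w is nonanticipating: for every t ∈ [0,T] and all w, v ∈ C_T, if w(s) = v(s) for all s ∈ [0,t], then x_w(s) = x_v(s) for all s ∈ [0,t]. -/
open Set MeasureTheory

open scoped Topology in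
/-- A continuous function dominated by a multiple of its own primitive vanishes. -/
theorem eq_zero_of_norm_le_mul_norm_primitive {a b K : ℝ} {f : ℝ → ℝ}
    (hf : ContinuousOn f (Icc a b))
    (hbound : ∀ x ∈ Icc a b, ‖f x‖ ≤ K * ‖∫ s in a..x, f s‖) :
    ∀ x ∈ Icc a b, f x = 0 := by
  intro x hx
  have hab : a ≤ b := hx.1.trans hx.2
  have hint : IntervalIntegrable f volume a b := hf.intervalIntegrable_of_Icc hab
  have hcont : ContinuousOn (fun y => ∫ s in a..y, f s) (Icc a b) := by
    simpa only [uIcc_of_le hab] using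
      intervalIntegral.continuousOn_primitive_interval' hint left_mem_uIcc
  have hderiv : ∀ y ∈ Ico a b,
      HasDerivWithinAt (fun y => ∫ s in a..y, f s) (f y) (Ici y) y := by
    intro y hy
    have hnhds : Icc a b ∈ 𝓝[>] y := Icc_mem_nhdsGT_of_mem hy
    exact intervalIntegral.integral_hasDerivWithinAt_right
      ((hf.mono (Icc_subset_Icc_right hy.2.le)).intervalIntegrable_of_Icc hy.1)
      ⟨Icc a b, hnhds, hf.aestronglyMeasurable measurableSet_Icc⟩
      ((hf y (Ico_subset_Icc_self hy)).mono_of_mem_nhdsWithin hnhds)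
  have hzero := eq_zero_of_abs_deriv_le_mul_abs_self_of_eq_zero_right hcont hderiv
    intervalIntegral.integral_same (fun y hy => hbound y (Ico_subset_Icc_self hy)) x hx
  simpa [hzero] using hbound x hx

/-- With `c` globally Lipschitz and `κ` bounded and globally Lipschitz,
the solution map `w ↦ x_w` of the Volterra-type equation
`x t = c (w t - ∫₀ᵗ κ (x s) ds)` is nonanticipating: for every `t ∈ [0,T]` and all
`w, v ∈ C_T`, if `w = v` on `[0,t]` then `x_w = x_v` on `[0,t]`. -/
theorem solution_map_nonanticipating
    (T : ℝ) (hT : 0 < T) (c κ : ℝ → ℝ)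
    (Lc : NNReal) (hc : LipschitzWith Lc c)
    (M : ℝ) (hκb : ∀ u : ℝ, |κ u| ≤ M)
    (Lκ : NNReal) (hκ : LipschitzWith Lκ κ)
    (w v : ℝ → ℝ) (hw : ContinuousOn w (Icc 0 T)) (hv : ContinuousOn v (Icc 0 T))
    (xw xv : ℝ → ℝ)
    (hxwc : ContinuousOn xw (Icc 0 T)) (hxvc : ContinuousOn xv (Icc 0 T))
    (hxw : ∀ t ∈ Icc (0:ℝ) T, xw t = c (w t - ∫ s in (0:ℝ)..t, κ (xw s)))
    (hxv : ∀ t ∈ Icc (0:ℝ) T, xv t = c (v t - ∫ s in (0:ℝ)..t, κ (xv s)))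
    (t : ℝ) (ht : t ∈ Icc (0:ℝ) T)
    (hagree : ∀ s ∈ Icc (0:ℝ) t, w s = v s) :
    ∀ s ∈ Icc (0:ℝ) t, xw s = xv s := by
  intro s hs
  have hsub : Icc (0 : ℝ) t ⊆ Icc 0 T := Icc_subset_Icc_right ht.2
  have hκw : ContinuousOn (fun r => κ (xw r)) (Icc 0 t) :=
    hκ.continuous.comp_continuousOn (hxwc.mono hsub)
  have hκv : ContinuousOn (fun r => κ (xv r)) (Icc 0 t) :=
    hκ.continuous.comp_continuousOn (hxvc.mono hsub)
  have hint : ∀ {f : ℝ → ℝ}, ContinuousOn f (Icc 0 t) → ∀ r ∈ Icc (0 : ℝ) t,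
      IntervalIntegrable f volume 0 r := fun hf r hr =>
    (hf.mono (Icc_subset_Icc_right hr.2)).intervalIntegrable_of_Icc hr.1
  have hdiff : ∀ r ∈ Icc (0 : ℝ) t, κ (xw r) - κ (xv r) = 0 := by
    refine eq_zero_of_norm_le_mul_norm_primitive (K := Lκ * Lc) (hκw.sub hκv) fun r hr => ?_
    calc ‖κ (xw r) - κ (xv r)‖
        ≤ Lκ * ‖xw r - xv r‖ := hκ.norm_sub_le _ _
      _ ≤ Lκ * (Lc * ‖(w r - ∫ s in (0 : ℝ)..r, κ (xw s)) -
            (v r - ∫ s in (0 : ℝ)..r, κ (xv s))‖) := by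
          rw [hxw r (hsub hr), hxv r (hsub hr)]
          gcongr
          exact hc.norm_sub_le _ _
      _ = Lκ * Lc * ‖∫ s in (0 : ℝ)..r, (κ (xw s) - κ (xv s))‖ := by
          rw [intervalIntegral.integral_sub (hint hκw r hr) (hint hκv r hr), hagree r hr,
            sub_sub_sub_cancel_left, norm_sub_rev, mul_assoc]
  have hintegral : ∫ r in (0 : ℝ)..s, κ (xw r) = ∫ r in (0 : ℝ)..s, κ (xv r) := by
    refine intervalIntegral.integral_congr fun r hr => ?_
    rw [uIcc_of_le hs.1] at hr
    exact sub_eq_zero.mp (hdiff r ⟨hr.1, hr.2.trans hs.2⟩)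
  rw [hxw s (hsub hs), hxv s (hsub hs), hagree s hs, hintegral]
end

section
/- Let T > 0, let c : ℝ → ℝ be globally Lipschitz, let κ : ℝ → ℝ be bounded and globally Lipschitz, and for w ∈ C_T let X(w) ∈ C_T denote the unique solution of X(w)(t) = c( w(t) − ∫₀ᵗ κ(X(w)(s)) ds ). Then for every continuous w̃ : [0,T] → ℝ, setting v(t) := w̃(t) + ∫₀ᵗ (κ ∘ c)(w̃(s)) ds, one has X(v)(t) = c(w̃(t)) for all t ∈ [0,T]. -/
open Set MeasureTheory

/-- A primitive `∫ₐᵗ g` that controls its own integrand, `|g t| ≤ K |∫ₐᵗ g|`, vanishes. -/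
theorem integral_eq_zero_of_abs_le_mul_abs_integral {a b K : ℝ} {g : ℝ → ℝ}
    (hg : ContinuousOn g (Icc a b))
    (hbound : ∀ t ∈ Icc a b, |g t| ≤ K * |∫ s in a..t, g s|) :
    ∀ t ∈ Icc a b, ∫ s in a..t, g s = 0 := by
  intro t ht
  have hab : a ≤ b := ht.1.trans ht.2
  set G : ℝ → ℝ := IccExtend hab ((Icc a b).domRestrict g)
  have hG : Continuous G := hg.domRestrict.Icc_extend'
  have hGg : ∀ s ∈ Icc a b, G s = g s := fun s hs => IccExtend_of_mem hab _ hs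
  have hGint : ∀ r ∈ Icc a b, ∫ s in a..r, G s = ∫ s in a..r, g s := fun r hr =>
    intervalIntegral.integral_congr fun s hs => by
      rw [uIcc_of_le hr.1] at hs
      exact hGg s ⟨hs.1, hs.2.trans hr.2⟩
  have hderiv : ∀ r, HasDerivAt (fun r => ∫ s in a..r, G s) (G r) r := fun r =>
    intervalIntegral.integral_hasDerivAt_right (hG.intervalIntegrable _ _)
      (hG.stronglyMeasurableAtFilter _ _) hG.continuousAt
  have hgronwall := norm_le_gronwallBound_of_norm_deriv_right_le (δ := 0) (K := K) (ε := 0)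
    (fun r _ => (hderiv r).continuousAt.continuousWithinAt)
    (fun r _ => (hderiv r).hasDerivWithinAt) (by simp)
    (fun r hr => by
      have hr' := Ico_subset_Icc_self hr
      simpa [hGg r hr', hGint r hr'] using hbound r hr') t ht
  rw [gronwallBound_ε0_δ0, hGint t ht] at hgronwall
  exact norm_le_zero_iff.mp hgronwall

/-- With `c` globally Lipschitz, `κ` bounded and globally Lipschitz, let
`X v` denote the unique solution of `X v t = c (v t - ∫₀ᵗ κ (X v s) ds)`. Then for every
continuous `w̃ : [0,T] → ℝ`, setting `v t := w̃ t + ∫₀ᵗ (κ ∘ c) (w̃ s) ds`, one has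
`X v t = c (w̃ t)` for all `t ∈ [0,T]`. (Here `x` denotes the solution `X v` for the
path `v`.) -/
theorem solution_of_translated_drift
    (T : ℝ) (hT : 0 < T) (c κ : ℝ → ℝ)
    (Lc : NNReal) (hc : LipschitzWith Lc c)
    (M : ℝ) (hκb : ∀ u : ℝ, |κ u| ≤ M)
    (Lκ : NNReal) (hκ : LipschitzWith Lκ κ)
    (wtil : ℝ → ℝ) (hwtil : ContinuousOn wtil (Icc 0 T))
    (v : ℝ → ℝ) (hv : ∀ t, v t = wtil t + ∫ s in (0:ℝ)..t, κ (c (wtil s)))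
    (x : ℝ → ℝ) (hxc : ContinuousOn x (Icc 0 T))
    (hx : ∀ t ∈ Icc (0:ℝ) T, x t = c (v t - ∫ s in (0:ℝ)..t, κ (x s))) :
    ∀ t ∈ Icc (0:ℝ) T, x t = c (wtil t) := by
  have hx_cont : ContinuousOn (fun s => κ (x s)) (Icc 0 T) := hκ.continuous.comp_continuousOn hxc
  have hw_cont : ContinuousOn (fun s => κ (c (wtil s))) (Icc 0 T) :=
    (hκ.continuous.comp hc.continuous).comp_continuousOn hwtil
  have hx_eq : ∀ t ∈ Icc (0:ℝ) T,
      x t = c (wtil t + ∫ s in (0:ℝ)..t, (κ (c (wtil s)) - κ (x s))) := by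
    intro t ht
    have hsub : uIcc 0 t ⊆ Icc 0 T := by
      rw [uIcc_of_le ht.1]
      exact Icc_subset_Icc_right ht.2
    rw [intervalIntegral.integral_sub (hw_cont.mono hsub).intervalIntegrable
      (hx_cont.mono hsub).intervalIntegrable, hx t ht, hv t, add_sub_assoc]
  have hzero := integral_eq_zero_of_abs_le_mul_abs_integral (K := Lκ * Lc)
    (g := fun s => κ (c (wtil s)) - κ (x s))
    (hw_cont.sub hx_cont) fun t ht => by
      have h := (hκ.comp hc).dist_le_mul (wtil t)
        (wtil t + ∫ s in (0:ℝ)..t, (κ (c (wtil s)) - κ (x s)))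
      simpa [Real.dist_eq, ← hx_eq t ht] using h
  intro t ht
  rw [hx_eq t ht, hzero t ht, add_zero]
end

section
/- Let T > 0, let c : ℝ → ℝ be globally Lipschitz, and let κ : ℝ → ℝ be bounded and globally Lipschitz. Then for every a ∈ ℝ and every continuous w : [0,T] → ℝ with w(0) = 0 there exists a unique continuous x : [0,T] → ℝ satisfying the shifted Volterra-type equation x(t) = c( a + w(t) − ∫₀ᵗ κ(x(s)) ds ) for all t ∈ [0,T], and this solution satisfies the initial condition x(0) = c(a). -/
open Set MeasureTheory

/-- The scalar initial value problem for `dz/dt = v t z`, `z 0 = 0`, has a solution on `[0, T]`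
when `v` is bounded, uniformly Lipschitz in space and continuous in time. -/
theorem exists_hasDerivWithinAt_of_bounded_lipschitz {T M : ℝ} (hT : 0 ≤ T) {v : ℝ → ℝ → ℝ}
    {K : NNReal} (hv : ∀ t, LipschitzWith K (v t))
    (hvc : ∀ z, ContinuousOn (fun t => v t z) (Icc 0 T)) (hvb : ∀ t z, |v t z| ≤ M) :
    ∃ z : ℝ → ℝ, z 0 = 0 ∧
      ∀ t ∈ Icc (0 : ℝ) T, HasDerivWithinAt z (v t (z t)) (Icc 0 T) t := by
  have hM : 0 ≤ M := (abs_nonneg _).trans (hvb 0 0)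
  have hpl : IsPicardLindelof v (tmin := 0) (tmax := T) ⟨0, left_mem_Icc.2 hT⟩ 0
      (⟨M, hM⟩ * ⟨T, hT⟩) 0 ⟨M, hM⟩ K :=
    { lipschitzOnWith := fun t _ => (hv t).lipschitzOnWith
      continuousOn := fun z _ => hvc z
      norm_le := fun t _ z _ => hvb t z
      mul_max_le := by
        change M * max (T - 0) (0 - 0) ≤ M * T - 0
        simp [hT] }
  exact hpl.exists_eq_forall_mem_Icc_hasDerivWithinAt₀

/-- The primitive of a function continuous on `[0, T]` has that function as its right derivative
on `[0, T)` and is continuous on `[0, T]`. -/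
theorem continuousOn_primitive_and_hasDerivWithinAt_Ici {T : ℝ} (hT : 0 ≤ T) {f : ℝ → ℝ}
    (hf : ContinuousOn f (Icc 0 T)) :
    ContinuousOn (fun t => ∫ s in (0 : ℝ)..t, f s) (Icc 0 T) ∧
      ∀ t ∈ Ico (0 : ℝ) T,
        HasDerivWithinAt (fun t => ∫ s in (0 : ℝ)..t, f s) (f t) (Ici t) t := by
  set g := IccExtend hT ((Icc 0 T).domRestrict f)
  have hg : Continuous g := hf.domRestrict.Icc_extend'
  have hgf : ∀ t ∈ Icc (0 : ℝ) T, g t = f t := fun t ht => IccExtend_of_mem _ _ ht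
  have hint : ∀ t ∈ Icc (0 : ℝ) T, ∫ s in (0 : ℝ)..t, f s = ∫ s in (0 : ℝ)..t, g s := by
    intro t ht
    refine intervalIntegral.integral_congr fun s hs => ?_
    rw [uIcc_of_le ht.1] at hs
    exact (hgf s ⟨hs.1, hs.2.trans ht.2⟩).symm
  have hder : ∀ t, HasDerivAt (fun t => ∫ s in (0 : ℝ)..t, g s) (g t) t :=
    fun t => (hg.integral_hasStrictDerivAt 0 t).hasDerivAt
  refine ⟨ContinuousOn.congr (fun t _ => (hder t).continuousAt.continuousWithinAt) hint, ?_⟩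
  intro t ht
  rw [← hgf t (Ico_subset_Icc_self ht)]
  refine (hder t).hasDerivWithinAt.congr_of_eventuallyEq ?_ (hint t (Ico_subset_Icc_self ht))
  filter_upwards [Icc_mem_nhdsGE ht.2] with s hs
  exact hint s ⟨ht.1.trans hs.1, hs.2⟩

/-- With `c` globally Lipschitz and `κ` bounded and globally Lipschitz,
for every `a ∈ ℝ` and continuous `w : [0,T] → ℝ` with `w 0 = 0` there is a unique
continuous `x : [0,T] → ℝ` satisfying the shifted Volterra-type equation
`x t = c (a + w t - ∫₀ᵗ κ (x s) ds)` on `[0,T]`, and this solution satisfies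
`x 0 = c a`. -/
theorem shifted_volterra_exists_unique
    (T : ℝ) (hT : 0 < T) (c κ : ℝ → ℝ)
    (Lc : NNReal) (hc : LipschitzWith Lc c)
    (M : ℝ) (hκb : ∀ u : ℝ, |κ u| ≤ M)
    (Lκ : NNReal) (hκ : LipschitzWith Lκ κ)
    (a : ℝ) (w : ℝ → ℝ) (hw : ContinuousOn w (Icc 0 T)) (hw0 : w 0 = 0) :
    ∃ x : ℝ → ℝ,
      (ContinuousOn x (Icc 0 T) ∧
        (∀ t ∈ Icc (0:ℝ) T, x t = c (a + w t - ∫ s in (0:ℝ)..t, κ (x s))) ∧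
        x 0 = c a) ∧
      ∀ y : ℝ → ℝ, ContinuousOn y (Icc 0 T) →
        (∀ t ∈ Icc (0:ℝ) T, y t = c (a + w t - ∫ s in (0:ℝ)..t, κ (y s))) →
        ∀ t ∈ Icc (0:ℝ) T, y t = x t := by
  set v : ℝ → ℝ → ℝ := fun t z => κ (c (a + IccExtend hT.le ((Icc 0 T).domRestrict w) t - z))
  have hvw : ∀ t ∈ Icc (0 : ℝ) T, ∀ z, v t z = κ (c (a + w t - z)) := fun t ht z => by
    simp only [v, IccExtend_of_mem _ _ ht, domRestrict_apply]
  have hv : ∀ t, LipschitzWith (Lκ * (Lc * 1)) (v t) := fun t =>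
    hκ.comp (hc.comp (LipschitzWith.of_dist_le_mul fun p q => by
      rw [dist_sub_left, NNReal.coe_one, one_mul]))
  have hvc : ∀ z, ContinuousOn (fun t => v t z) (Icc 0 T) := fun z =>
    (hκ.continuous.comp (hc.continuous.comp
      ((continuous_const.add hw.domRestrict.Icc_extend').sub continuous_const))).continuousOn
  obtain ⟨z, hz0, hz⟩ :=
    exists_hasDerivWithinAt_of_bounded_lipschitz hT.le hv hvc fun _ _ => hκb _
  have hzc : ContinuousOn z (Icc 0 T) := fun t ht => (hz t ht).continuousWithinAt
  have hzd : ∀ t ∈ Ico (0 : ℝ) T, HasDerivWithinAt z (v t (z t)) (Ici t) t := fun t ht =>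
    (hz t (Ico_subset_Icc_self ht)).mono_of_mem_nhdsWithin
      (Filter.mem_of_superset (Icc_mem_nhdsGE ht.2) (Icc_subset_Icc_left ht.1))
  have hxc : ContinuousOn (fun t => c (a + w t - z t)) (Icc 0 T) :=
    hc.continuous.comp_continuousOn ((continuousOn_const.add hw).sub hzc)
  have hzint : ∀ t ∈ Icc (0 : ℝ) T, ∫ s in (0 : ℝ)..t, κ (c (a + w s - z s)) = z t := by
    obtain ⟨hPc, hPd⟩ := continuousOn_primitive_and_hasDerivWithinAt_Ici hT.le
      (hκ.continuous.comp_continuousOn hxc)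
    refine eq_of_has_deriv_right_eq hPd (fun t ht => ?_) hPc hzc (by simp [hz0])
    simpa [hvw t (Ico_subset_Icc_self ht)] using hzd t ht
  refine ⟨fun t => c (a + w t - z t), ⟨hxc, fun t ht => by rw [hzint t ht],
    by simp [hw0, hz0]⟩, ?_⟩
  intro y hyc hy t ht
  obtain ⟨hPc, hPd⟩ := continuousOn_primitive_and_hasDerivWithinAt_Ici hT.le
    (hκ.continuous.comp_continuousOn hyc)
  have heq : EqOn (fun t => ∫ s in (0 : ℝ)..t, κ (y s)) z (Icc 0 T) := by
    refine ODE_solution_unique hv hPc (fun t ht => ?_) hzc hzd (by simp [hz0])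
    rw [hvw t (Ico_subset_Icc_self ht), ← hy t (Ico_subset_Icc_self ht)]
    exact hPd t ht
  rw [hy t ht]
  exact congrArg (fun r => c (a + w t - r)) (heq ht)
end
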